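/- Let A ∈ M_d(ℤ) be an invertible matrix with |det A| = 1 and no eigenvalue of modulus one, and let T : 𝕋^d → 𝕋^d be the induced hyperbolic toral automorphism on 𝕋^d = ℝ^d/ℤ^d. Then Obs(T) = 1, i.e., there exists a continuous function f : 𝕋^d → ℝ that observes T. -/

import Mathlib

open Set Topology Function

/-- The endomorphism of the torus `𝕋^d = ℝ^d/ℤ^d` (realized as `Fin d → ℝ/ℤ`) induced by an
integer matrix `A`, i.e. `T(x + ℤ^d) = Ax + ℤ^d`. -/
noncomputable def toralEndo (d : ℕ) (A : Matrix (Fin d) (Fin d) ℤ) :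
    (Fin d → UnitAddCircle) → (Fin d → UnitAddCircle) :=
  fun x i => ∑ j, A i j • x j

/-- The observability number of `T : X → X`: the minimal `m ≥ 1` for which there exists a
continuous `f : X → ℝ^m` observing `T` (`⊤` if no such `m` exists). -/
noncomputable def obsNum {X : Type*} [TopologicalSpace X] (T : X → X) : ℕ∞ :=
  sInf {m : ℕ∞ | ∃ k : ℕ, m = (k : ℕ∞) ∧ 1 ≤ k ∧
    ∃ f : C(X, EuclideanSpace ℝ (Fin k)),
      ∀ x y : X, x ≠ y → ∃ n : ℕ, f (T^[n] x) ≠ f (T^[n] y)}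

theorem ContinuousMap.exists_eqOn_of_finite {X : Type*} [TopologicalSpace X] [T4Space X]
    {s : Set X} (hs : s.Finite) (g : X → ℝ) : ∃ f : C(X, ℝ), EqOn f g s := by
  have : Finite s := hs
  obtain ⟨f, hf⟩ := ContinuousMap.exists_restrict_eq hs.isClosed
    (⟨s.domRestrict g, continuous_of_discreteTopology⟩ : C(s, ℝ))
  exact ⟨f, fun x hx => DFunLike.congr_fun hf ⟨x, hx⟩⟩

/-- The orbit of a non-periodic point under an injective map is injectively parametrized. -/
theorem Function.Injective.iterate_injective_of_notMem_periodicPts {X : Type*} {T : X → X}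
    (hT : Injective T) {x : X} (hx : x ∉ periodicPts T) : Injective fun n : ℕ => T^[n] x := by
  have key : ∀ m k : ℕ, T^[m] x = T^[m + k] x → k = 0 := by
    intro m k h
    by_contra hk
    rw [iterate_add_apply] at h
    exact hx ⟨k, Nat.pos_of_ne_zero hk, ((hT.iterate m) h).symm⟩
  intro m n h
  rcases le_total m n with hmn | hmn
  · obtain ⟨k, rfl⟩ := Nat.exists_eq_add_of_le hmn
    simp [key m k h]
  · obtain ⟨k, rfl⟩ := Nat.exists_eq_add_of_le hmn
    simp [key n k h.symm]

/-- The discrete cohomological equation `a (n + k) - a n = t n` is solvable. -/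
theorem exists_seq_add_sub_eq {k : ℕ} (hk : 0 < k) (t : ℕ → ℝ) :
    ∃ a : ℕ → ℝ, ∀ n, a (n + k) - a n = t n := by
  refine ⟨fun n => ∑ i ∈ Finset.range (n / k), t (n % k + k * i), fun n => ?_⟩
  simp only [Nat.add_div_right n hk, Nat.add_mod_right, Finset.sum_range_succ, Nat.mod_add_div]
  ring

/-- Along the orbits of two distinct points, the first of which is not periodic, the differences
of the values of a function can be prescribed arbitrarily. -/
theorem exists_sub_iterate_eq_of_notMem_periodicPts {X : Type*} {T : X → X} (hT : Injective T)
    {x y : X} (hxy : x ≠ y) (hx : x ∉ periodicPts T) (t : ℕ → ℝ) :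
    ∃ g : X → ℝ, ∀ n, g (T^[n] x) - g (T^[n] y) = t n := by
  have hxi := hT.iterate_injective_of_notMem_periodicPts hx
  by_cases h₁ : ∃ k, y = T^[k] x
  · obtain ⟨k, rfl⟩ := h₁
    have hk : 0 < k := Nat.pos_of_ne_zero fun h => hxy (by simp [h])
    obtain ⟨a, ha⟩ := exists_seq_add_sub_eq hk (fun n => -t n)
    refine ⟨extend (fun n : ℕ => T^[n] x) a 0, fun n => ?_⟩
    have h₁ := hxi.extend_apply a 0 n
    have h₂ := hxi.extend_apply a 0 (n + k)
    simp only [iterate_add_apply] at h₁ h₂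
    rw [h₁, h₂]
    linarith [ha n]
  by_cases h₂ : ∃ k, x = T^[k] y
  · obtain ⟨k, rfl⟩ := h₂
    have hk : 0 < k := Nat.pos_of_ne_zero fun h => hxy (by simp [h])
    have hy : y ∉ periodicPts T := fun hy => hx <| by
      obtain ⟨m, hm, hy⟩ := hy
      exact ⟨m, hm, hy.apply_iterate k⟩
    have hyi := hT.iterate_injective_of_notMem_periodicPts hy
    obtain ⟨a, ha⟩ := exists_seq_add_sub_eq hk t
    refine ⟨extend (fun n : ℕ => T^[n] y) a 0, fun n => ?_⟩
    have h₁ := hyi.extend_apply a 0 n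
    have h₂ := hyi.extend_apply a 0 (n + k)
    simp only [iterate_add_apply] at h₁ h₂
    rw [h₁, h₂, ha]
  · refine ⟨extend (fun n : ℕ => T^[n] x) t 0, fun n => ?_⟩
    have h₃ : ¬ ∃ m, T^[m] x = T^[n] y := by
      rintro ⟨m, hm⟩
      rcases le_total m n with hmn | hmn
      · obtain ⟨k, rfl⟩ := Nat.exists_eq_add_of_le hmn
        rw [iterate_add_apply] at hm
        exact h₂ ⟨k, hT.iterate m hm⟩
      · obtain ⟨k, rfl⟩ := Nat.exists_eq_add_of_le hmn
        rw [iterate_add_apply] at hm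
        exact h₁ ⟨k, (hT.iterate n hm).symm⟩
    rw [hxi.extend_apply t 0 n, extend_apply' _ _ _ h₃]
    simp

theorem exists_sub_iterate_eq {X : Type*} {T : X → X} (hT : Injective T) {x y : X} (hxy : x ≠ y)
    (h : ¬ (x ∈ periodicPts T ∧ y ∈ periodicPts T)) (t : ℕ → ℝ) :
    ∃ g : X → ℝ, ∀ n, g (T^[n] x) - g (T^[n] y) = t n := by
  rcases not_and_or.1 h with hx | hy
  · exact exists_sub_iterate_eq_of_notMem_periodicPts hT hxy hx t
  · obtain ⟨g, hg⟩ := exists_sub_iterate_eq_of_notMem_periodicPts hT hxy.symm hy fun n => -t n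
    exact ⟨g, fun n => by linarith [hg n]⟩

/-- The difference of the vectors of the first `M` observations of the two points of `p`, as a
function of the observable. -/
noncomputable def delayDiff {X : Type*} [TopologicalSpace X] (T : X → X) (M : ℕ) (p : X × X) :
    C(X, ℝ) →L[ℝ] (Fin M → ℝ) :=
  ContinuousLinearMap.pi fun n =>
    ContinuousMap.evalCLM ℝ (T^[n] p.1) - ContinuousMap.evalCLM ℝ (T^[n] p.2)

theorem delayDiff_apply {X : Type*} [TopologicalSpace X] (T : X → X) (M : ℕ) (p : X × X)
    (f : C(X, ℝ)) (n : Fin M) : delayDiff T M p f n = f (T^[n] p.1) - f (T^[n] p.2) := rfl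

theorem delayDiff_surjective {X : Type*} [TopologicalSpace X] [T4Space X] {T : X → X}
    (hT : Injective T) {x y : X} (hxy : x ≠ y)
    (h : ¬ (x ∈ periodicPts T ∧ y ∈ periodicPts T)) (M : ℕ) :
    Surjective (delayDiff T M (x, y)) := by
  intro t
  obtain ⟨g, hg⟩ := exists_sub_iterate_eq hT hxy h fun n => if hn : n < M then t ⟨n, hn⟩ else 0
  obtain ⟨f, hf⟩ := ContinuousMap.exists_eqOn_of_finite
    ((finite_range fun n : Fin M => T^[n] x).union (finite_range fun n : Fin M => T^[n] y)) g
  refine ⟨f, funext fun n => ?_⟩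
  rw [delayDiff_apply, hf (Or.inl ⟨n, rfl⟩), hf (Or.inr ⟨n, rfl⟩), hg]
  simp

theorem continuous_delayDiff {X : Type*} [TopologicalSpace X] [LocallyCompactSpace X]
    {T : X → X} (hT : Continuous T) (M : ℕ) :
    Continuous fun q : C(X, ℝ) × (X × X) => delayDiff T M q.2 q.1 := by
  refine continuous_pi fun n => ?_
  simp only [delayDiff_apply]
  have := hT.iterate n
  fun_prop

theorem isOpen_forall_delayDiff_ne_zero {X : Type*} [TopologicalSpace X] [LocallyCompactSpace X]
    {T : X → X} (hT : Continuous T) (M : ℕ) {K : Set (X × X)} (hK : IsCompact K) :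
    IsOpen {f : C(X, ℝ) | ∀ p ∈ K, delayDiff T M p f ≠ 0} := by
  refine isOpen_iff_eventually.2 fun f hf => ?_
  refine hK.eventually_forall_of_forall_eventually fun p hp => ?_
  exact ((continuous_delayDiff hT M).continuousAt (x := (f, p))).eventually_ne (hf p hp)

/-- The observables whose pullback along `π` is continuously differentiable. -/
def smoothAlong {E X : Type*} [NormedAddCommGroup E] [NormedSpace ℝ E] [TopologicalSpace X]
    (π : E → X) : Subalgebra ℝ C(X, ℝ) where
  carrier := {f | ContDiff ℝ 1 (f ∘ π)}
  mul_mem' {f g} hf hg := by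
    have hf' : ContDiff ℝ 1 (f ∘ π) := hf
    exact hf'.mul hg
  add_mem' {f g} hf hg := by
    have hf' : ContDiff ℝ 1 (f ∘ π) := hf
    exact hf'.add hg
  algebraMap_mem' c := show ContDiff ℝ 1 fun _ : E => algebraMap ℝ ℝ c from contDiff_const

theorem contDiff_delayDiff {E X : Type*} [NormedAddCommGroup E] [NormedSpace ℝ E]
    [TopologicalSpace X] {π : E → X} {T : X → X} {L : E → E} (hL : ContDiff ℝ 1 L)
    (hLT : Semiconj π L T) (M : ℕ) {f : C(X, ℝ)} (hf : f ∈ smoothAlong π) :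
    ContDiff ℝ 1 fun q : E × E => delayDiff T M (π q.1, π q.2) f := by
  refine contDiff_pi.2 fun n => ?_
  have hLn : ContDiff ℝ 1 L^[n] := by
    induction (n : ℕ) with
    | zero => exact contDiff_id
    | succ k ih => exact ih.comp hL
  simp only [delayDiff_apply, ← (hLT.iterate_right n).eq]
  have hf' : ContDiff ℝ 1 (f ∘ π) := hf
  exact (hf'.comp (hLn.comp contDiff_fst)).sub (hf'.comp (hLn.comp contDiff_snd))

/-- The solutions `a` of a linear system `G q *ᵥ a = v q` depending smoothly on a parameter `q`
ranging over a space of dimension less than `M` miss a dense set. -/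
theorem dense_compl_image_inv_mulVec {E : Type*} [NormedAddCommGroup E] [NormedSpace ℝ E]
    [FiniteDimensional ℝ E] {M : ℕ} (hM : Module.finrank ℝ E < M)
    {G : E → Matrix (Fin M) (Fin M) ℝ} {v : E → Fin M → ℝ}
    (hG : ∀ i j, ContDiff ℝ 1 fun q => G q i j) (hv : ContDiff ℝ 1 v) :
    Dense ((fun q => (G q)⁻¹.mulVec (v q)) '' {q | (G q).det ≠ 0})ᶜ := by
  have hdet : ∀ H : E → Matrix (Fin M) (Fin M) ℝ, (∀ i j, ContDiff ℝ 1 fun q => H q i j) →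
      ContDiff ℝ 1 fun q => (H q).det := by
    intro H hH
    simp only [Matrix.det_apply]
    exact ContDiff.sum fun σ _ => (contDiff_prod fun i _ => hH _ _).const_smul _
  have hadj : ∀ i j, ContDiff ℝ 1 fun q => (G q).adjugate i j := by
    intro i j
    simp only [Matrix.adjugate_apply]
    refine hdet _ fun k l => ?_
    simp only [Matrix.updateRow_apply]
    split_ifs
    · exact contDiff_const
    · exact hG k l
  refine dense_compl_of_dimH_lt_finrank ?_
  refine (dimH_image_le_of_locally_lipschitzOn fun q hq => ?_).trans_lt
    (((dimH_mono (subset_univ _)).trans_eq (Real.dimH_univ_eq_finrank E)).trans_lt ?_)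
  · have : ContDiffAt ℝ 1 (fun q => (G q)⁻¹.mulVec (v q)) q := by
      refine contDiffAt_pi.2 fun i => ?_
      simp only [Matrix.mulVec, dotProduct, Matrix.inv_def, Matrix.smul_apply, Ring.inverse_eq_inv',
        smul_eq_mul]
      refine ContDiffAt.sum fun j _ => ?_
      exact (((hdet G hG).contDiffAt.inv hq).mul (hadj i j).contDiffAt).mul
        (contDiff_pi.1 hv j).contDiffAt
    obtain ⟨C, t, ht, hlip⟩ := this.exists_lipschitzOnWith
    exact ⟨C, t, mem_nhdsWithin_of_mem_nhds ht, hlip⟩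
  · simpa using hM

/-- If the vectors of the first `M` observations can be prescribed arbitrarily at a pair of points
and `M` exceeds the dimension of `E × E`, a generic observable separates all pairs nearby. -/
theorem exists_nhds_residual_delayDiff_ne_zero {E X : Type*} [NormedAddCommGroup E] [NormedSpace ℝ E]
    [FiniteDimensional ℝ E] [TopologicalSpace X] [CompactSpace X] [T2Space X] {π : E → X}
    (hπ : Surjective π) (hsep : (smoothAlong π).SeparatesPoints) {T : X → X} (hT : Continuous T)
    {L : E → E} (hL : ContDiff ℝ 1 L) (hLT : Semiconj π L T) {M : ℕ}
    (hM : 2 * Module.finrank ℝ E < M) {p₀ : X × X} (hp₀ : Surjective (delayDiff T M p₀)) :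
    ∃ K ∈ 𝓝 p₀, {f : C(X, ℝ) | ∀ p ∈ K, delayDiff T M p f ≠ 0} ∈ residual C(X, ℝ) := by
  have hS : Dense (smoothAlong π : Set C(X, ℝ)) := by
    rw [← dense_closure, ← Subalgebra.topologicalClosure_coe,
      ContinuousMap.subalgebra_topologicalClosure_eq_top_of_separatesPoints _ hsep]
    exact dense_univ
  have hSp : (Subalgebra.toSubmodule (smoothAlong π)).map (delayDiff T M p₀).toLinearMap = ⊤ := by
    have hd : Dense (delayDiff T M p₀ '' (smoothAlong π : Set C(X, ℝ))) :=
      hp₀.denseRange.dense_image (delayDiff T M p₀).continuous hS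
    have htop : ∀ W : Submodule ℝ (Fin M → ℝ), Dense (W : Set (Fin M → ℝ)) → W = ⊤ := fun W hW =>
      SetLike.coe_injective (W.closed_of_finiteDimensional.closure_eq.symm.trans hW.closure_eq)
    exact htop _ hd
  have hφ : ∀ i : Fin M, ∃ φ ∈ smoothAlong π, delayDiff T M p₀ φ = Pi.single i 1 := fun i =>
    (hSp ▸ Submodule.mem_top : Pi.single i (1 : ℝ) ∈
      (Subalgebra.toSubmodule (smoothAlong π)).map (delayDiff T M p₀).toLinearMap)
  choose φ hφS hφ using hφ
  let G : X × X → Matrix (Fin M) (Fin M) ℝ := fun p => Matrix.of fun n i => delayDiff T M p (φ i) n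
  have hGmul : ∀ p a, delayDiff T M p (∑ i, a i • φ i) = (G p).mulVec a := by
    intro p a
    ext n
    simp [G, Matrix.mulVec, dotProduct, mul_comm]
  have hGc : Continuous fun p => (G p).det := by
    refine Continuous.matrix_det (continuous_matrix fun n i => ?_)
    exact (continuous_apply n).comp ((continuous_delayDiff hT M).comp (Continuous.prodMk_right (φ i)))
  have hG₀ : (G p₀).det ≠ 0 := by
    have : G p₀ = 1 := by
      ext n i
      simp [G, hφ, Matrix.one_apply, Pi.single_apply]
    simp [this]
  obtain ⟨K, hKc, hKn, hK⟩ : ∃ K, IsCompact K ∧ K ∈ 𝓝 p₀ ∧ ∀ p ∈ K, (G p).det ≠ 0 := by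
    obtain ⟨K, hK, hKs, hKc⟩ := local_compact_nhds (hGc.continuousAt.eventually_ne hG₀)
    exact ⟨K, hKc, hK, hKs⟩
  refine ⟨K, hKn, residual_of_dense_open (isOpen_forall_delayDiff_ne_zero hT M hKc) ?_⟩
  rw [← dense_closure]
  refine hS.mono fun f hf => ?_
  have hB := dense_compl_image_inv_mulVec (E := E × E) (M := M)
    (G := fun q => G (π q.1, π q.2)) (v := fun q => -delayDiff T M (π q.1, π q.2) f)
    (by rw [Module.finrank_prod]; omega)
    (fun i j => contDiff_pi.1 (contDiff_delayDiff hL hLT M (hφS j)) i)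
    (contDiff_delayDiff hL hLT M hf).neg
  have hc : Continuous fun a : Fin M → ℝ => f + ∑ i, a i • φ i := by fun_prop
  have h0 := image_closure_subset_closure_image hc (mem_image_of_mem _ (hB 0))
  simp only [Pi.zero_apply, zero_smul, Finset.sum_const_zero, add_zero] at h0
  refine closure_mono ?_ h0
  rintro _ ⟨a, ha, rfl⟩ p hp h
  obtain ⟨u, hu⟩ := hπ p.1
  obtain ⟨w, hw⟩ := hπ p.2
  refine ha ⟨(u, w), ?_, ?_⟩
  · simpa [hu, hw] using hK p hp
  · simp only [hu, hw, Prod.mk.eta]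
    rw [map_add, hGmul, add_comm, add_eq_zero_iff_eq_neg] at h
    rw [← h, Matrix.mulVec_mulVec, Matrix.nonsing_inv_mul _ (isUnit_iff_ne_zero.2 (hK p hp)),
      Matrix.one_mulVec]

theorem residual_apply_ne {X : Type*} [TopologicalSpace X] [CompactSpace X] [T2Space X]
    {x y : X} (hxy : x ≠ y) : {f : C(X, ℝ) | f x ≠ f y} ∈ residual C(X, ℝ) := by
  classical
  let e : C(X, ℝ) →L[ℝ] ℝ := ContinuousMap.evalCLM ℝ x - ContinuousMap.evalCLM ℝ y
  have he : {f : C(X, ℝ) | f x ≠ f y} = (e.ker : Set C(X, ℝ))ᶜ := by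
    ext f
    simp [e, sub_eq_zero]
  rw [he]
  refine residual_of_dense_open e.isClosed_ker.isOpen_compl ?_
  rw [← interior_eq_empty_iff_dense_compl]
  by_contra hne
  have htop := Submodule.eq_top_of_nonempty_interior' _ (nonempty_iff_ne_empty.2 hne)
  obtain ⟨f, hf⟩ := ContinuousMap.exists_eqOn_of_finite (toFinite {x, y}) (Pi.single x (1 : ℝ))
  have : f ∈ e.ker := htop ▸ Submodule.mem_top
  have h1 : f x = 1 := by rw [hf (by simp)]; simp
  have h2 : f y = 0 := by rw [hf (by simp)]; simp [hxy.symm]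
  simp [e, h1, h2] at this

/-- A finite-dimensional system covered by a smooth one, injective and with countably many
periodic points, is observed by a real-valued continuous function. -/
theorem exists_observing_of_countable_periodicPts {E X : Type*} [NormedAddCommGroup E]
    [NormedSpace ℝ E] [FiniteDimensional ℝ E] [TopologicalSpace X] [CompactSpace X] [T2Space X]
    [SecondCountableTopology X] {π : E → X} (hπ : Surjective π)
    (hsep : (smoothAlong π).SeparatesPoints) {T : X → X} (hT : Continuous T) (hTi : Injective T)
    {L : E → E} (hL : ContDiff ℝ 1 L) (hLT : Semiconj π L T) (hper : (periodicPts T).Countable) :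
    ∃ f : C(X, ℝ), ∀ x y, x ≠ y → ∃ n : ℕ, f (T^[n] x) ≠ f (T^[n] y) := by
  let M := 2 * Module.finrank ℝ E + 1
  let N : Set (X × X) := {p | p.1 ≠ p.2 ∧ ¬ (p.1 ∈ periodicPts T ∧ p.2 ∈ periodicPts T)}
  have hloc : ∀ p : X × X, ∃ K : Set (X × X), p ∈ N →
      K ∈ 𝓝 p ∧ {f : C(X, ℝ) | ∀ q ∈ K, delayDiff T M q f ≠ 0} ∈ residual C(X, ℝ) := by
    intro p
    by_cases hp : p ∈ N
    · obtain ⟨K, hK⟩ := exists_nhds_residual_delayDiff_ne_zero hπ hsep hT hL hLT (Nat.lt_succ_self _)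
        (delayDiff_surjective hTi hp.1 hp.2 M)
      exact ⟨K, fun _ => hK⟩
    · exact ⟨∅, fun h => absurd h hp⟩
  choose K hK using hloc
  obtain ⟨t, htN, htc, hcov⟩ := TopologicalSpace.countable_cover_nhdsWithin (s := N) (f := K)
    fun p hp => mem_nhdsWithin_of_mem_nhds (hK p hp).1
  have h₁ : ∀ᶠ f in residual C(X, ℝ), ∀ p ∈ t, ∀ q ∈ K p, delayDiff T M q f ≠ 0 :=
    (eventually_countable_ball htc).2 fun p hp => (hK p (htN hp)).2
  have h₂ : ∀ᶠ f in residual C(X, ℝ), ∀ p ∈ periodicPts T ×ˢ periodicPts T, p.1 ≠ p.2 →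
      (f : C(X, ℝ)) p.1 ≠ f p.2 := by
    refine (eventually_countable_ball (hper.prod hper)).2 fun p _ => ?_
    by_cases hp : p.1 = p.2
    · simp [hp]
    · filter_upwards [residual_apply_ne hp] with f hf _ using hf
  obtain ⟨f, hf₁, hf₂⟩ := (dense_of_mem_residual (h₁.and h₂)).nonempty
  refine ⟨f, fun x y hxy => ?_⟩
  by_cases hp : x ∈ periodicPts T ∧ y ∈ periodicPts T
  · exact ⟨0, hf₂ (x, y) hp hxy⟩
  · obtain ⟨p, hpt, hpK⟩ := mem_iUnion₂.1 (hcov (show (x, y) ∈ N from ⟨hxy, hp⟩))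
    obtain ⟨n, hn⟩ := Function.ne_iff.1 (hf₁ p hpt _ hpK)
    exact ⟨n, sub_ne_zero.1 hn⟩

/-- The covering map `ℝ^d → 𝕋^d`. -/
def toTorus (d : ℕ) (u : Fin d → ℝ) : Fin d → UnitAddCircle := fun i => (u i : UnitAddCircle)

theorem toTorus_surjective (d : ℕ) : Surjective (toTorus d) := by
  intro x
  choose u hu using fun i => QuotientAddGroup.mk_surjective (x i)
  exact ⟨u, funext hu⟩

theorem toralEndo_mul (d : ℕ) (A B : Matrix (Fin d) (Fin d) ℤ) :
    toralEndo d (A * B) = toralEndo d A ∘ toralEndo d B := by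
  ext x i
  simp only [toralEndo, comp_apply, Matrix.mul_apply, Finset.sum_smul, Finset.smul_sum, mul_smul]
  exact Finset.sum_comm

theorem toralEndo_one (d : ℕ) : toralEndo d 1 = id := by
  ext x i
  simp [toralEndo, Matrix.one_apply]

theorem toralEndo_pow (d : ℕ) (A : Matrix (Fin d) (Fin d) ℤ) (n : ℕ) :
    toralEndo d (A ^ n) = (toralEndo d A)^[n] := by
  induction n with
  | zero => simp [toralEndo_one]
  | succ n ih => rw [pow_succ, toralEndo_mul, ih, iterate_succ]

theorem continuous_toralEndo (d : ℕ) (A : Matrix (Fin d) (Fin d) ℤ) :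
    Continuous (toralEndo d A) := by
  unfold toralEndo
  fun_prop

theorem toralEndo_injective {d : ℕ} {A : Matrix (Fin d) (Fin d) ℤ} (hA : IsUnit A.det) :
    Injective (toralEndo d A) := by
  refine LeftInverse.injective (g := toralEndo d A⁻¹) fun x => ?_
  rw [← comp_apply (f := toralEndo d A⁻¹), ← toralEndo_mul, Matrix.nonsing_inv_mul _ hA,
    toralEndo_one, id]

theorem toTorus_semiconj (d : ℕ) (A : Matrix (Fin d) (Fin d) ℤ) :
    Semiconj (toTorus d) (A.map (Int.cast : ℤ → ℝ)).mulVec (toralEndo d A) := by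
  intro u
  ext i
  simp only [toTorus, toralEndo, Matrix.mulVec, dotProduct, Matrix.map_apply, ← AddCircle.coe_zsmul,
    zsmul_eq_mul]
  exact map_sum (QuotientAddGroup.mk' (AddSubgroup.zmultiples (1 : ℝ))) _ _

theorem smoothAlong_toTorus_separatesPoints (d : ℕ) :
    (smoothAlong (toTorus d)).SeparatesPoints := by
  intro x y hxy
  obtain ⟨i, hi⟩ := Function.ne_iff.1 hxy
  let c : C(Fin d → UnitAddCircle, ℂ) :=
    ⟨fun z => (AddCircle.toCircle (z i) : ℂ), by fun_prop⟩
  have hc : ContDiff ℝ 1 fun u => c (toTorus d u) := by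
    have : (fun u => c (toTorus d u)) = fun u : Fin d → ℝ =>
        Complex.exp (((2 * Real.pi / 1 * u i : ℝ) : ℂ) * Complex.I) := by
      ext u
      simp [c, toTorus, AddCircle.toCircle_apply_mk]
    rw [this]
    have h : ContDiff ℝ 1 fun u : Fin d → ℝ => ((2 * Real.pi / 1 * u i : ℝ) : ℂ) :=
      Complex.ofRealCLM.contDiff.comp (contDiff_const.mul (contDiff_apply ℝ ℝ i))
    exact (h.mul contDiff_const).cexp
  by_cases hre : (c x).re = (c y).re
  · refine ⟨_, ⟨⟨fun z => (c z).im, by fun_prop⟩, Complex.imCLM.contDiff.comp hc, rfl⟩, ?_⟩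
    intro him
    exact hi (AddCircle.injective_toCircle one_ne_zero (Subtype.ext (Complex.ext hre him)))
  · exact ⟨_, ⟨⟨fun z => (c z).re, by fun_prop⟩, Complex.reCLM.contDiff.comp hc, rfl⟩, hre⟩

theorem det_pow_sub_one_ne_zero {d : ℕ} {A : Matrix (Fin d) (Fin d) ℤ}
    (hhyp : ∀ z : ℂ, ((A.map (Int.cast : ℤ → ℂ)).charpoly).IsRoot z → ‖z‖ ≠ 1)
    {n : ℕ} (hn : 0 < n) : (A ^ n - 1).det ≠ 0 := by
  intro h
  set B := A.map (Int.cast : ℤ → ℂ)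
  have hdet : (B ^ n - 1).det = 0 := by
    have := congrArg (Int.castRingHom ℂ) h
    rw [RingHom.map_det, map_sub, map_pow, map_one, map_zero] at this
    exact this
  have h1 : (1 : ℂ) ∈ spectrum ℂ (B ^ n) := by
    rw [spectrum.mem_iff, map_one, Matrix.isUnit_iff_isUnit_det, ← neg_sub, Matrix.det_neg, hdet]
    simp
  rw [spectrum.map_pow_of_pos B hn] at h1
  obtain ⟨z, hz, hzn⟩ := h1
  refine hhyp z (Matrix.mem_spectrum_iff_isRoot_charpoly.1 hz) ?_
  exact Complex.norm_eq_one_of_pow_eq_one hzn hn.ne'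

theorem countable_periodicPts_toralEndo {d : ℕ} {A : Matrix (Fin d) (Fin d) ℤ}
    (hA : ∀ n : ℕ, 0 < n → (A ^ n - 1).det ≠ 0) : (periodicPts (toralEndo d A)).Countable := by
  let B : ℕ → Matrix (Fin d) (Fin d) ℝ := fun n => (A ^ n - 1).map (Int.cast : ℤ → ℝ)
  have hsub : periodicPts (toralEndo d A) ⊆ range fun q : ℕ × (Fin d → ℤ) =>
      toTorus d ((B q.1)⁻¹.mulVec fun i => (q.2 i : ℝ)) := by
    rintro x ⟨n, hn, hx⟩
    obtain ⟨u, rfl⟩ := toTorus_surjective d x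
    have hx : toralEndo d (A ^ n) (toTorus d u) = toTorus d u := by rw [toralEndo_pow]; exact hx
    rw [← (toTorus_semiconj d (A ^ n)).eq] at hx
    have hm : ∀ i, ∃ m : ℤ, (m : ℝ) = (B n).mulVec u i := by
      intro i
      have hBi : (B n).mulVec u i = ((A ^ n).map (Int.cast : ℤ → ℝ)).mulVec u i - u i := by
        have : B n = (A ^ n).map (Int.cast : ℤ → ℝ) - 1 := by
          simp only [B]
          rw [Matrix.map_sub _ Int.cast_sub, Matrix.map_one _ Int.cast_zero Int.cast_one]
        rw [this, Matrix.sub_mulVec, Matrix.one_mulVec, Pi.sub_apply]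
      have h0 : (((B n).mulVec u i : ℝ) : UnitAddCircle) = 0 := by
        rw [hBi, AddCircle.coe_sub, sub_eq_zero]
        exact congrFun hx i
      obtain ⟨m, hm⟩ := (AddCircle.coe_eq_zero_iff _).1 h0
      exact ⟨m, by simpa using hm⟩
    choose m hm using hm
    refine ⟨(n, m), ?_⟩
    have hdet : IsUnit (B n).det := by
      have : (B n).det = ((A ^ n - 1).det : ℝ) := ((Int.castRingHom ℝ).map_det _).symm
      rw [this]
      exact isUnit_iff_ne_zero.2 (Int.cast_ne_zero.2 (hA n hn))
    simp only [hm]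
    congr 1
    change (B n)⁻¹.mulVec ((B n).mulVec u) = u
    rw [Matrix.mulVec_mulVec, Matrix.nonsing_inv_mul _ hdet, Matrix.one_mulVec]
  exact (countable_range _).mono hsub

theorem obsNum_eq_one_of_exists {X : Type*} [TopologicalSpace X] {T : X → X}
    (h : ∃ f : C(X, ℝ), ∀ x y : X, x ≠ y → ∃ n : ℕ, f (T^[n] x) ≠ f (T^[n] y)) :
    obsNum T = 1 := by
  obtain ⟨f, hf⟩ := h
  refine le_antisymm (sInf_le ⟨1, by simp, le_rfl,
    ⟨fun x => WithLp.toLp 2 fun _ => f x, by fun_prop⟩, fun x y hxy => ?_⟩) (le_sInf ?_)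
  · obtain ⟨n, hn⟩ := hf x y hxy
    exact ⟨n, fun h => hn (congrArg (fun v : EuclideanSpace ℝ (Fin 1) => v 0) h)⟩
  · rintro _ ⟨k, rfl, hk, -⟩
    exact_mod_cast hk

/-- A hyperbolic toral automorphism (|det A| = 1, no eigenvalue of modulus one) has
observability number 1: some continuous `f : 𝕋^d → ℝ` observes it. -/
theorem stmt8 (d : ℕ) (A : Matrix (Fin d) (Fin d) ℤ)
    (hdet : A.det.natAbs = 1)
    (hhyp : ∀ z : ℂ, ((A.map (Int.cast : ℤ → ℂ)).charpoly).IsRoot z → ‖z‖ ≠ 1) :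
    obsNum (toralEndo d A) = 1 ∧
      ∃ f : C(Fin d → UnitAddCircle, ℝ), ∀ x y : Fin d → UnitAddCircle, x ≠ y →
        ∃ n : ℕ, f ((toralEndo d A)^[n] x) ≠ f ((toralEndo d A)^[n] y) := by
  have h := exists_observing_of_countable_periodicPts (toTorus_surjective d)
    (smoothAlong_toTorus_separatesPoints d) (continuous_toralEndo d A)
    (toralEndo_injective (Int.isUnit_iff_natAbs_eq.2 hdet))
    (LinearMap.toContinuousLinearMap (A.map (Int.cast : ℤ → ℝ)).mulVecLin).contDiff
    (toTorus_semiconj d A)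
    (countable_periodicPts_toralEndo fun _ hn => det_pow_sub_one_ne_zero hhyp hn)
  exact ⟨obsNum_eq_one_of_exists h, h⟩
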